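/- Let u, v ∈ ℚ² ∖ ℤ² with u ≢ ±v (mod ℤ²). Then for all τ ∈ ℍ: (f_u(τ) − f_v(τ))⁶ = 2¹²·3⁶ · j(τ)² · (j(τ) − 1728)³ · g_{u+v}(τ)⁶ g_{u−v}(τ)⁶ / (g_u(τ)¹² g_v(τ)¹²). -/

import Mathlib

noncomputable section

open Complex Matrix UpperHalfPlane MatrixGroups

abbrev SL2Z := Matrix.SpecialLinearGroup (Fin 2) ℤ

/-- `e2pi z = exp(2πiz)`. -/
def e2pi (z : ℂ) : ℂ := Complex.exp (2 * Real.pi * Complex.I * z)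

/-- `qpow τ x = q^x = exp(2πixτ)`. -/
def qpow (τ : ℍ) (x : ℂ) : ℂ := Complex.exp (2 * Real.pi * Complex.I * x * τ)

/-- The lattice point `mτ + n` for `p = (m, n)`. -/
def latticePt (τ : ℍ) (p : ℤ × ℤ) : ℂ := (p.1 : ℂ) * τ + (p.2 : ℂ)

/-- Weierstrass invariant `g₂` of the lattice `[τ, 1]`. -/
def g2fun (τ : ℍ) : ℂ := 60 * ∑' p : {p : ℤ × ℤ // p ≠ 0}, (latticePt τ p.1)⁻¹ ^ 4

/-- Weierstrass invariant `g₃` of the lattice `[τ, 1]`. -/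
def g3fun (τ : ℍ) : ℂ := 140 * ∑' p : {p : ℤ × ℤ // p ≠ 0}, (latticePt τ p.1)⁻¹ ^ 6

/-- The discriminant `Δ = g₂³ - 27g₃²`. -/
def deltaFun (τ : ℍ) : ℂ := g2fun τ ^ 3 - 27 * g3fun τ ^ 2

/-- The elliptic modular function `j = 1728 g₂³/Δ`. -/
def jfun (τ : ℍ) : ℂ := 1728 * g2fun τ ^ 3 / deltaFun τ

/-- The Weierstrass `℘`-function of the lattice `[τ, 1]`. -/
def wpfun (τ : ℍ) (z : ℂ) : ℂ :=
  z⁻¹ ^ 2 + ∑' p : {p : ℤ × ℤ // p ≠ 0},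
    ((z - latticePt τ p.1)⁻¹ ^ 2 - (latticePt τ p.1)⁻¹ ^ 2)

/-- The Fricke function `f_v = -2⁷3⁵ (g₂g₃/Δ) ℘(v₁τ + v₂)`. -/
def fricke (v : ℚ × ℚ) (τ : ℍ) : ℂ :=
  -(2 ^ 7 * 3 ^ 5 : ℂ) * g2fun τ * g3fun τ / deltaFun τ *
    wpfun τ ((v.1 : ℂ) * τ + (v.2 : ℂ))

/-- The Siegel function `g_v`, via its `q`-product expansion. -/
def siegel (v : ℚ × ℚ) (τ : ℍ) : ℂ :=
  -Complex.exp (Real.pi * Complex.I * (v.2 : ℂ) * ((v.1 : ℂ) - 1)) *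
    qpow τ (((v.1 : ℂ) ^ 2 - (v.1 : ℂ) + 1 / 6) / 2) *
    (1 - qpow τ (v.1 : ℂ) * e2pi (v.2 : ℂ)) *
    ∏' n : ℕ,
      ((1 - qpow τ ((n : ℂ) + 1 + (v.1 : ℂ)) * e2pi (v.2 : ℂ)) *
       (1 - qpow τ ((n : ℂ) + 1 - (v.1 : ℂ)) * e2pi (-(v.2 : ℂ))))

/-- Extend a function on `ℍ` to `ℂ` by junk values. -/
def asComplexFun (h : ℍ → ℂ) : ℂ → ℂ :=
  fun z => if hz : 0 < z.im then h ⟨z, hz⟩ else 0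

/-- `h` is holomorphic on `ℍ`. -/
def IsHoloOnH (h : ℍ → ℂ) : Prop :=
  DifferentiableOn ℂ (asComplexFun h) {z : ℂ | 0 < z.im}

/-- `h` is meromorphic on `ℍ`. -/
def IsMeromOnH (h : ℍ → ℂ) : Prop :=
  MeromorphicOn (asComplexFun h) {z : ℂ | 0 < z.im}

/-- `v ∈ V_N`: `v = (a/N, b/N)` with `gcd(a, b, N) = 1`. -/
def InVN (N : ℕ) (v : ℚ × ℚ) : Prop :=
  ∃ a b : ℤ, v.1 = (a : ℚ) / (N : ℚ) ∧ v.2 = (b : ℚ) / (N : ℚ) ∧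
    Int.gcd a (Int.gcd b (N : ℤ)) = 1

/-- `v ∈ ℤ²`. -/
def IsIntPair (v : ℚ × ℚ) : Prop := ∃ m n : ℤ, v.1 = (m : ℚ) ∧ v.2 = (n : ℚ)

/-- `u ≡ v (mod ℤ²)`. -/
def EqModZ2 (u v : ℚ × ℚ) : Prop := IsIntPair (u.1 - v.1, u.2 - v.2)

/-- `u ≡ ±v (mod ℤ²)`. -/
def PMEquiv (u v : ℚ × ℚ) : Prop := EqModZ2 u v ∨ EqModZ2 u (-v.1, -v.2)

/-- The action `v ↦ ᵗγ·v` of a matrix on a rational pair. -/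
def tAct (γ : Matrix (Fin 2) (Fin 2) ℤ) (v : ℚ × ℚ) : ℚ × ℚ :=
  ((γ 0 0 : ℚ) * v.1 + (γ 1 0 : ℚ) * v.2, (γ 0 1 : ℚ) * v.1 + (γ 1 1 : ℚ) * v.2)

/-- `h` agrees, near `i∞`, with the expansion `∑_{n ≥ n₀} σ_d(c_n) q^{n/N}` where the
coefficients `c_n ∈ ℚ(ζ_N)` are recorded as polynomials in `ζ_N` with rational coefficients
and `σ_d(c_n)` is obtained by evaluating at `ζ_N^d`. -/
def QExp (N : ℕ) (c : ℤ → Polynomial ℚ) (n₀ : ℤ) (d : ℤ) (h : ℍ → ℂ) : Prop :=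
  ∃ A : ℝ, ∀ τ : ℍ, A < τ.im →
    h τ = ∑' n : ℕ, (Polynomial.aeval (e2pi ((d : ℂ) / (N : ℂ))) (c (n₀ + (n : ℤ)))) *
      qpow τ (((n₀ + (n : ℤ) : ℤ) : ℂ) / (N : ℂ))

/-- `h` is meromorphic at `i∞`, with a Fourier expansion in powers of `q^{1/N}`. -/
def CuspExp (N : ℕ) (h : ℍ → ℂ) : Prop :=
  ∃ (n₀ : ℤ) (c : ℤ → ℂ) (A : ℝ), ∀ τ : ℍ, A < τ.im →
    h τ = ∑' n : ℕ, c (n₀ + (n : ℤ)) * qpow τ (((n₀ + (n : ℤ) : ℤ) : ℂ) / (N : ℂ))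

/-- `h` has a Fourier expansion in powers of `q^{1/N}` with rational coefficients. -/
def RatQExp (N : ℕ) (h : ℍ → ℂ) : Prop :=
  ∃ (n₀ : ℤ) (c : ℤ → ℚ) (A : ℝ), ∀ τ : ℍ, A < τ.im →
    h τ = ∑' n : ℕ, (c (n₀ + (n : ℤ)) : ℂ) * qpow τ (((n₀ + (n : ℤ) : ℤ) : ℂ) / (N : ℂ))

/-- `γ ∈ Γ(N)`, i.e. `γ ≡ I₂ (mod N)`. -/
def InGammaN (N : ℕ) (γ : SL2Z) : Prop :=
  ((γ 0 0 : ℤ) : ZMod N) = 1 ∧ ((γ 0 1 : ℤ) : ZMod N) = 0 ∧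
  ((γ 1 0 : ℤ) : ZMod N) = 0 ∧ ((γ 1 1 : ℤ) : ZMod N) = 1

/-- `γ ∈ Γ¹(N)`, i.e. `γ ≡ [[1,0],[*,1]] (mod N)`. -/
def InGamma1Lower (N : ℕ) (γ : SL2Z) : Prop :=
  ((γ 0 0 : ℤ) : ZMod N) = 1 ∧ ((γ 0 1 : ℤ) : ZMod N) = 0 ∧ ((γ 1 1 : ℤ) : ZMod N) = 1

/-- `γ ∈ Γ₁(N)`, i.e. `γ ≡ [[1,*],[0,1]] (mod N)`. -/
def InGamma1Upper (N : ℕ) (γ : SL2Z) : Prop :=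
  ((γ 0 0 : ℤ) : ZMod N) = 1 ∧ ((γ 1 0 : ℤ) : ZMod N) = 0 ∧ ((γ 1 1 : ℤ) : ZMod N) = 1

/-- `h ∈ F_N`: meromorphic on `ℍ`, modular for `Γ(N)`, meromorphic at the cusps and
with Fourier coefficients in `ℚ(ζ_N)`. -/
structure MemFN (N : ℕ) (h : ℍ → ℂ) : Prop where
  merom : IsMeromOnH h
  modular : ∀ γ : SL2Z, InGammaN N γ → ∀ τ : ℍ, h (γ • τ) = h τ
  cusp : ∀ γ : SL2Z, CuspExp N (fun τ => h (γ • τ))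
  coeff : ∃ (c : ℤ → Polynomial ℚ) (n₀ : ℤ), QExp N c n₀ 1 h

/-- `h ∈ F¹_N(ℚ)`: meromorphic on `ℍ`, modular for `Γ¹(N)`, meromorphic at the cusps and
with rational Fourier coefficients. -/
structure MemF1N (N : ℕ) (h : ℍ → ℂ) : Prop where
  merom : IsMeromOnH h
  modular : ∀ γ : SL2Z, InGamma1Lower N γ → ∀ τ : ℍ, h (γ • τ) = h τ
  cusp : ∀ γ : SL2Z, CuspExp N (fun τ => h (γ • τ))
  ratQ : RatQExp N h

/-- `h ∈ O¹_N(ℚ)`: the weakly holomorphic elements of `F¹_N(ℚ)`. -/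
def MemO1N (N : ℕ) (h : ℍ → ℂ) : Prop := MemF1N N h ∧ IsHoloOnH h

/-- `β ∈ SL₂(ℤ)` is a lift of `[[1,0],[0,det γ]]⁻¹ · γ (mod N)`, so that
`γ ≡ [[1,0],[0,det γ]] · β (mod N)`. -/
def SLCompat (N : ℕ) (γ : Matrix (Fin 2) (Fin 2) ℤ) (β : SL2Z) : Prop :=
  ((β 0 0 : ℤ) : ZMod N) = ((γ 0 0 : ℤ) : ZMod N) ∧
  ((β 0 1 : ℤ) : ZMod N) = ((γ 0 1 : ℤ) : ZMod N) ∧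
  ((γ.det : ℤ) : ZMod N) * ((β 1 0 : ℤ) : ZMod N) = ((γ 1 0 : ℤ) : ZMod N) ∧
  ((γ.det : ℤ) : ZMod N) * ((β 1 1 : ℤ) : ZMod N) = ((γ 1 1 : ℤ) : ZMod N)

/-- Condition (F3): for every `γ ∈ GL₂(ℤ/Nℤ)`, written as `[[1,0],[0,d]]·β` with
`d = det γ` and `β ∈ SL₂(ℤ/Nℤ)`, one has `h_v^γ = h_{ᵗγ·v}`; here `h_v^γ = (σ_d h_v) ∘ β`
is expressed through `q`-expansions. -/
def GaloisCompat (N : ℕ) (h : (ℚ × ℚ) → ℍ → ℂ) : Prop :=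
  ∀ v : ℚ × ℚ, InVN N v →
    ∀ γ : Matrix (Fin 2) (Fin 2) ℤ, Int.gcd γ.det (N : ℤ) = 1 →
      ∀ β : SL2Z, SLCompat N γ β →
        ∀ (c : ℤ → Polynomial ℚ) (n₀ : ℤ), QExp N c n₀ 1 (h v) →
          QExp N c n₀ γ.det (fun τ => h (tAct γ v) (β⁻¹ • τ))

/-- A Fricke family of level `N`. -/
structure IsFrickeFamily (N : ℕ) (h : (ℚ × ℚ) → ℍ → ℂ) : Prop where
  mem : ∀ v : ℚ × ℚ, InVN N v → MemFN N (h v)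
  holo : ∀ v : ℚ × ℚ, InVN N v → IsHoloOnH (h v)
  pm : ∀ u v : ℚ × ℚ, InVN N u → InVN N v → PMEquiv u v → h u = h v
  galois : GaloisCompat N h

/-- `ζ₃ = e^{2πi/3}` as a point of `ℍ`. -/
def zeta3H : ℍ := ⟨Complex.exp (2 * Real.pi * Complex.I / 3), by
  have h : (2 * Real.pi * Complex.I / 3 : ℂ) = Complex.I * ((2 * Real.pi / 3 : ℝ) : ℂ) := by
    push_cast; ring
  rw [h]
  rw [show Complex.I * ((2 * Real.pi / 3 : ℝ) : ℂ) = (((2 * Real.pi / 3 : ℝ) : ℂ) * Complex.I) by ring]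
  rw [Complex.exp_ofReal_mul_I_im]
  exact Real.sin_pos_of_pos_of_lt_pi (by positivity) (by nlinarith [Real.pi_pos])⟩

/-- `ζ₄ = i` as a point of `ℍ`. -/
def zeta4H : ℍ := ⟨Complex.I, by simp⟩

/-- The set of points of `ℂ` lying in the `SL₂(ℤ)`-orbit of `ζ₃` or `ζ₄`. -/
def exceptionalSet : Set ℂ :=
  {z : ℂ | ∃ γ : SL2Z, z = ((γ • zeta3H : ℍ) : ℂ) ∨ z = ((γ • zeta4H : ℍ) : ℂ)}

/-- `ℍ' = ℍ ∖ {γζ₃, γζ₄ : γ ∈ SL₂(ℤ)}`, as a subset of `ℂ`. -/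
def upperHalfPlaneSlit : Set ℂ := {z : ℂ | 0 < z.im} \ exceptionalSet

/-- `h` is holomorphic on `ℍ'`. -/
def IsHoloOnH' (h : ℍ → ℂ) : Prop :=
  DifferentiableOn ℂ (asComplexFun h) upperHalfPlaneSlit

/-- Multiplication of a point of `ℍ` by `4`. -/
def fourH (τ : ℍ) : ℍ := ⟨4 * (τ : ℂ), by
  have h : (0:ℝ) < (τ : ℂ).im := τ.2
  have h4 : (4 * (τ : ℂ)).im = 4 * (τ : ℂ).im := by
    simp [Complex.mul_im]
  rw [h4]; linarith⟩


/-! ### The discriminant -/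

lemma lattice_sum_eq (τ : ℍ) (k : ℕ) (hk : 3 ≤ k) :
    ∑' p : {p : ℤ × ℤ // p ≠ 0}, (latticePt τ p.1)⁻¹ ^ k =
      2 * riemannZeta k * ModularForm.E hk τ := by
  have h1 := tsum_eisSummand_eq_riemannZeta_mul_eisensteinSeries hk τ
  have h2 : ModularForm.E hk τ = (1 / 2 : ℂ) * eisensteinSeries (N := 1) 0 k τ := rfl
  rw [h2, show 2 * riemannZeta k * (1 / 2 * eisensteinSeries (N := 1) 0 (k : ℤ) τ) =
    riemannZeta k * eisensteinSeries (N := 1) 0 k τ by ring, ← h1,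
    ← (finTwoArrowEquiv ℤ).symm.tsum_eq]
  have h3 : ∀ p : ℤ × ℤ, EisensteinSeries.eisSummand k ((finTwoArrowEquiv ℤ).symm p) τ
      = (latticePt τ p)⁻¹ ^ k := by
    intro p
    simp [EisensteinSeries.eisSummand, latticePt]
  simp_rw [h3]
  refine tsum_subtype_eq_of_support_subset (s := {p : ℤ × ℤ | p ≠ 0})
    (f := fun p => (latticePt τ p)⁻¹ ^ k) ?_
  intro p hp hp0
  apply hp
  subst hp0
  simp [latticePt]
  omega

lemma riemannZeta_six' : riemannZeta 6 = (Real.pi : ℂ) ^ 6 / 945 := by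
  have := riemannZeta_two_mul_nat (k := 3) (by norm_num)
  norm_num at this
  rw [this, show bernoulli 6 = 1 / 42 by decide +kernel]
  norm_num [Nat.factorial]
  ring

lemma deltaFun_eq (τ : ℍ) :
    deltaFun τ = (2 * Real.pi) ^ 12 * ModularForm.discriminant τ := by
  rw [ModularForm.discriminant_eq_E₄_cube_sub_E₆_sq]
  have h4 := lattice_sum_eq τ 4 (by norm_num)
  have h6 := lattice_sum_eq τ 6 (by norm_num)
  push_cast at h4 h6
  rw [riemannZeta_four] at h4
  rw [riemannZeta_six'] at h6
  rw [deltaFun, g2fun, g3fun, h4, h6]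
  ring

lemma deltaFun_ne_zero (τ : ℍ) : deltaFun τ ≠ 0 := by
  rw [deltaFun_eq]
  have := ModularForm.discriminant_ne_zero τ
  have := Real.pi_ne_zero
  simp_all

/-! ### The period pair -/

/-- The period pair `(τ, 1)`. -/
def periodPair (τ : ℍ) : PeriodPair where
  ω₁ := τ
  ω₂ := 1
  indep := by
    rw [LinearIndependent.pair_iff]
    intro s t h
    have hi := congrArg Complex.im h
    have hs : s = 0 := by
      simpa [τ.im_ne_zero] using hi
    subst hs
    simpa using h

lemma wpfun_eq (τ : ℍ) (z : ℂ) : wpfun τ z = (periodPair τ).weierstrassP z := by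
  classical
  have hs := ((periodPair τ).hasSum_weierstrassP z)
  have h3 : ∀ p : ℤ × ℤ, ((periodPair τ).latticeEquivProd.symm p).1 = latticePt τ p := by
    intro p
    rw [PeriodPair.latticeEquiv_symm_apply]
    simp [periodPair, latticePt]
  have hs' : HasSum (fun p : ℤ × ℤ => 1 / (z - latticePt τ p) ^ 2 - 1 / latticePt τ p ^ 2)
      ((periodPair τ).weierstrassP z) := by
    rw [← (periodPair τ).latticeEquivProd.symm.toEquiv.hasSum_iff] at hs
    refine hs.congr_fun ?_ 
    intro p
    simp [h3]
  rw [← hs'.tsum_eq, hs'.summable.tsum_eq_add_tsum_ite 0]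
  have : latticePt τ 0 = 0 := by simp [latticePt]
  rw [this, wpfun]
  congr 1
  · simp
  · rw [← tsum_subtype_eq_of_support_subset (s := {p : ℤ × ℤ | p ≠ 0})]
    · refine tsum_congr fun p => ?_
      rw [if_neg p.2]
      simp
    · intro p hp hp0
      apply hp
      simp [hp0]

/-! ### The theta product -/

/-- `∏ (1 - q ^ (n + 1) x)`. -/
def qProd (q x : ℂ) : ℂ := ∏' n : ℕ, (1 - q ^ (n + 1) * x)

lemma summable_qProd {q : ℂ} (hq : ‖q‖ < 1) (x : ℂ) :
    Summable fun n : ℕ => ‖-(q ^ (n + 1) * x)‖ := by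
  simp only [norm_neg, norm_mul, norm_pow]
  exact ((summable_nat_add_iff 1).mpr
    (summable_geometric_of_lt_one (norm_nonneg q) hq)).mul_right _

lemma multipliable_qProd {q : ℂ} (hq : ‖q‖ < 1) (x : ℂ) :
    Multipliable fun n : ℕ => (1 - q ^ (n + 1) * x) := by
  simp_rw [sub_eq_add_neg]
  exact multipliable_one_add_of_summable (summable_qProd hq x)

lemma qProd_ne_zero {q x : ℂ} (hq : ‖q‖ < 1) (hx : ∀ n : ℕ, q ^ (n + 1) * x ≠ 1) :
    qProd q x ≠ 0 := by
  unfold qProd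
  simp_rw [sub_eq_add_neg]
  refine tprod_one_add_ne_zero_of_summable ?_ (summable_qProd hq x)
  intro n h
  exact hx n (by linear_combination -h)

lemma qProd_mul {q : ℂ} (hq : ‖q‖ < 1) (hq0 : q ≠ 0) (x : ℂ) :
    qProd q x = (1 - q * x) * qProd q (q * x) := by
  unfold qProd
  have h : ∀ n : ℕ, 1 - q ^ (n + 1) * (q * x) = 1 - q ^ (n + 1 + 1) * x := by
    intro n; ring
  simp_rw [h]
  have := multipliable_qProd hq (q * x)
  simp_rw [h] at this
  have h2 := tprod_eq_zero_mul' (f := fun n : ℕ => 1 - q ^ (n + 1) * x)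
  simpa using h2 this

lemma differentiable_qProd {q : ℂ} (hq : ‖q‖ < 1) : Differentiable ℂ (qProd q) := by
  have key : HasProdLocallyUniformlyOn (fun (n : ℕ) x => 1 + -(q ^ (n + 1) * x))
      (fun x => ∏' n : ℕ, (1 + -(q ^ (n + 1) * x))) Set.univ := by
    apply hasProdLocallyUniformlyOn_of_forall_compact isOpen_univ
    intro K _ hcK
    obtain ⟨R, hR⟩ := hcK.isBounded.exists_norm_le
    refine (((summable_nat_add_iff 1).mpr
      (summable_geometric_of_lt_one (norm_nonneg q) hq)).mul_right R).hasProdUniformlyOn_nat_one_add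
      hcK (.of_forall fun n x hx ↦ ?_) (fun _ ↦ by fun_prop)
    simp only [norm_neg, norm_mul, norm_pow]
    gcongr
    exact hR x hx
  have h2 := key.differentiableOn (.of_forall fun _ ↦ by
    simpa [Finset.prod_fn] using DifferentiableOn.finsetProd (fun _ _ ↦ by fun_prop)) isOpen_univ
  rw [differentiableOn_univ] at h2
  have h3 : qProd q = fun x => ∏' n : ℕ, (1 + -(q ^ (n + 1) * x)) := by
    ext x; simp [qProd, sub_eq_add_neg]
  rw [h3]; exact h2

lemma e2pi_add (z w : ℂ) : e2pi (z + w) = e2pi z * e2pi w := by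
  simp [e2pi, mul_add, Complex.exp_add]

lemma e2pi_ne_zero (z : ℂ) : e2pi z ≠ 0 := Complex.exp_ne_zero _

lemma e2pi_neg (z : ℂ) : e2pi (-z) = (e2pi z)⁻¹ := by
  simp [e2pi, Complex.exp_neg]

@[simp] lemma e2pi_zero : e2pi 0 = 1 := by simp [e2pi]

lemma e2pi_sub (z w : ℂ) : e2pi (z - w) = e2pi z * (e2pi w)⁻¹ := by
  rw [sub_eq_add_neg, e2pi_add, e2pi_neg]

lemma e2pi_one : e2pi 1 = 1 := by
  simp [e2pi, Complex.exp_two_pi_mul_I]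

lemma e2pi_eq_one {z : ℂ} (h : e2pi z = 1) : ∃ n : ℤ, z = n := by
  rw [e2pi, Complex.exp_eq_one_iff] at h
  obtain ⟨n, hn⟩ := h
  refine ⟨n, ?_⟩
  have := Complex.two_pi_I_ne_zero
  apply mul_left_cancel₀ this
  linear_combination hn

lemma e2pi_nat_mul (n : ℕ) (z : ℂ) : e2pi (n * z) = e2pi z ^ n := by
  rw [e2pi, e2pi, ← Complex.exp_nat_mul]
  congr 1; ring

@[fun_prop] lemma differentiable_e2pi : Differentiable ℂ e2pi := by
  unfold e2pi
  fun_prop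

lemma norm_e2pi_lt (τ : ℍ) : ‖e2pi τ‖ < 1 := norm_exp_two_pi_I_lt_one τ

/-- The part of the theta function without zero at the origin. -/
def thetaU (τ : ℍ) (z : ℂ) : ℂ := qProd (e2pi τ) (e2pi z) * qProd (e2pi τ) (e2pi (-z))

/-- The theta function as a product. -/
def theta (τ : ℍ) (z : ℂ) : ℂ := (1 - e2pi z) * thetaU τ z

lemma differentiable_thetaU (τ : ℍ) : Differentiable ℂ (thetaU τ) := by
  have := differentiable_qProd (norm_e2pi_lt τ)
  unfold thetaU
  fun_prop

lemma differentiable_theta (τ : ℍ) : Differentiable ℂ (theta τ) := by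
  have := differentiable_thetaU τ
  unfold theta
  fun_prop

lemma theta_neg (τ : ℍ) (z : ℂ) : theta τ (-z) = -(e2pi z)⁻¹ * theta τ z := by
  have := e2pi_ne_zero z
  simp only [theta, thetaU, e2pi_neg, neg_neg, inv_inv]
  field_simp
  ring

lemma theta_add_one (τ : ℍ) (z : ℂ) : theta τ (z + 1) = theta τ z := by
  simp only [theta, thetaU, e2pi_neg, e2pi_add, e2pi_one, mul_one]

lemma theta_add_tau (τ : ℍ) (z : ℂ) : theta τ (z + τ) = -(e2pi z)⁻¹ * theta τ z := by
  have hx := e2pi_ne_zero z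
  have hq := e2pi_ne_zero τ
  have h1 := qProd_mul (norm_e2pi_lt τ) hq (e2pi z)
  have h2 := qProd_mul (norm_e2pi_lt τ) hq ((e2pi z)⁻¹ * (e2pi τ)⁻¹)
  rw [show e2pi τ * ((e2pi z)⁻¹ * (e2pi τ)⁻¹) = (e2pi z)⁻¹ by field_simp] at h2
  simp only [theta, thetaU, e2pi_neg, e2pi_add, mul_inv]
  rw [h2, h1, mul_comm (e2pi z) (e2pi τ)]
  field_simp
  ring

lemma theta_zero (τ : ℍ) : theta τ 0 = 0 := by simp [theta]

lemma thetaU_ne_zero (τ : ℍ) (z : ℂ) (hz : ∀ m n : ℤ, m ≠ 0 → z ≠ m * τ + n) :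
    thetaU τ z ≠ 0 := by
  refine mul_ne_zero (qProd_ne_zero (norm_e2pi_lt τ) ?_) (qProd_ne_zero (norm_e2pi_lt τ) ?_)
  · intro n h
    rw [← e2pi_nat_mul, ← e2pi_add] at h
    obtain ⟨k, hk⟩ := e2pi_eq_one h
    refine hz (-(n + 1)) k (by omega) ?_
    push_cast at hk ⊢
    linear_combination hk
  · intro n h
    rw [← e2pi_nat_mul, ← e2pi_add] at h
    obtain ⟨k, hk⟩ := e2pi_eq_one h
    refine hz (n + 1) (-k) (by omega) ?_
    push_cast at hk ⊢
    linear_combination -hk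

lemma theta_ne_zero (τ : ℍ) (z : ℂ) (hz : ∀ m n : ℤ, z ≠ m * τ + n) : theta τ z ≠ 0 := by
  refine mul_ne_zero ?_ (thetaU_ne_zero τ z fun m n _ => hz m n)
  intro h
  obtain ⟨k, hk⟩ := e2pi_eq_one (z := z) (by linear_combination -h)
  exact hz 0 k (by simpa using hk)

lemma thetaU_zero_ne_zero (τ : ℍ) : thetaU τ 0 ≠ 0 := by
  apply thetaU_ne_zero
  intro m n hm h
  have := congrArg Complex.im h
  simp [τ.im_ne_zero, hm] at this

/-! ### Liouville for elliptic functions -/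

lemma elliptic_const (L : PeriodPair) (G H : ℂ → ℂ)
    (hd : ∀ z, z ∉ L.lattice → AnalyticAt ℂ G z)
    (hper : ∀ (z : ℂ) (l : L.lattice), G (z + l) = G z)
    (heven : ∀ z, G (-z) = G z)
    (hH : AnalyticAt ℂ H 0) (hH0 : H 0 = 0)
    (hGH : ∀ᶠ z in nhds 0, z ≠ 0 → z ^ 2 * G z = H z) :
    ∃ c, ∀ z, z ∉ L.lattice → G z = c := by
  classical
  have hHe : (fun z => H (-z)) =ᶠ[nhds 0] H := by
    have h2 : ∀ᶠ z in nhds (0 : ℂ), -z ≠ 0 → (-z) ^ 2 * G (-z) = H (-z) := by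
      have : Filter.Tendsto (fun z : ℂ => -z) (nhds 0) (nhds 0) := by
        simpa using (continuous_neg (G := ℂ)).tendsto 0
      exact this.eventually hGH
    filter_upwards [hGH, h2] with z h1 h2
    by_cases hz : z = 0
    · simp [hz]
    · rw [← h1 hz, ← h2 (by simpa using hz), heven]; ring
  have hderiv : deriv H 0 = 0 := by
    have h1 := hHe.deriv_eq
    rw [deriv_comp_neg] at h1
    simp only [neg_zero] at h1
    linear_combination -(1/2 : ℂ) * h1
  have hord : ((2 : ℕ) : ℕ∞) ≤ analyticOrderAt H 0 := by
    rw [natCast_le_analyticOrderAt_iff_iteratedDeriv_eq_zero hH]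
    intro i hi
    interval_cases i
    · simpa using hH0
    · simpa using hderiv
  rw [natCast_le_analyticOrderAt hH] at hord
  obtain ⟨K, hK, hHK⟩ := hord
  set F : ℂ → ℂ := fun z => if z ∈ L.lattice then K 0 else G z with hF
  have hFper : ∀ (z : ℂ) (l : L.lattice), F (z + l) = F z := by
    intro z l
    simp only [hF, hper]
    congr 1
    simpa using (L.lattice.toAddSubgroup.add_mem_cancel_right (y := z) l.2)
  have hF0 : AnalyticAt ℂ F 0 := by
    refine hK.congr ?_
    filter_upwards [hHK, hGH, L.compl_lattice_sdiff_singleton_mem_nhds 0] with z h1 h2 h3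
    by_cases hz : z = 0
    · simp [hF, hz]
    · have hzL : z ∉ L.lattice := by simp_all
      have h4 := h2 hz
      rw [h1] at h4
      simp only [hF, hzL, if_false]
      simp only [sub_zero, smul_eq_mul] at h4
      exact (mul_left_cancel₀ (pow_ne_zero 2 hz) h4).symm
  have hFan : ∀ x, AnalyticAt ℂ F x := by
    intro x
    by_cases hx : x ∈ L.lattice
    · lift x to L.lattice using hx
      have h := hF0
      rw [← sub_self x.1] at h
      have h2 := h.comp (f := (· - x.1)) (by fun_prop)
      refine h2.congr (Filter.Eventually.of_forall fun a => ?_)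
      have := hFper (a - x.1) x
      simpa using this.symm
    · refine (hd x hx).congr ?_
      filter_upwards [L.isClosed_lattice.isOpen_compl.mem_nhds hx] with y hy
      have : y ∉ L.lattice := hy
      simp [hF, this]
  have hdiff : Differentiable ℂ F := fun x => (hFan x).differentiableAt
  refine ⟨K 0, fun z hz => ?_⟩
  have := (hdiff.apply_eq_apply_of_bounded (IsZLattice.isCompact_range_of_periodic L.lattice _
    hdiff.continuous fun z w hw ↦ by lift w to L.lattice using hw; exact hFper z w).isBounded z 0)
  simpa [hF, hz] using this

lemma mem_lattice_iff (τ : ℍ) (z : ℂ) :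
    z ∈ (periodPair τ).lattice ↔ ∃ m n : ℤ, z = m * τ + n := by
  rw [PeriodPair.mem_lattice]
  simp [periodPair, eq_comm]

/-- The quotient `θ(z+w)θ(z-w)/θ(z)²`. -/
def thetaQuot (τ : ℍ) (w z : ℂ) : ℂ := theta τ (z + w) * theta τ (z - w) / theta τ z ^ 2

lemma thetaQuot_neg (τ : ℍ) (w z : ℂ) : thetaQuot τ w (-z) = thetaQuot τ w z := by
  have := e2pi_ne_zero z
  have := e2pi_ne_zero w
  rw [thetaQuot, show -z + w = -(z - w) by ring, show -z - w = -(z + w) by ring]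
  simp only [theta_neg, thetaQuot, e2pi_add, e2pi_sub]
  by_cases h : theta τ z = 0
  · simp [h]
  · field_simp

lemma thetaQuot_add_tau (τ : ℍ) (w z : ℂ) : thetaQuot τ w (z + τ) = thetaQuot τ w z := by
  have := e2pi_ne_zero z
  have := e2pi_ne_zero w
  rw [thetaQuot, show z + τ + w = (z + w) + τ by ring, show z + τ - w = (z - w) + τ by ring]
  simp only [theta_add_tau, thetaQuot, e2pi_add, e2pi_sub]
  by_cases h : theta τ z = 0
  · simp [h]
  · field_simp

lemma thetaQuot_add_one (τ : ℍ) (w z : ℂ) : thetaQuot τ w (z + 1) = thetaQuot τ w z := by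
  rw [thetaQuot, show z + 1 + w = (z + w) + 1 by ring, show z + 1 - w = (z - w) + 1 by ring]
  simp only [theta_add_one, thetaQuot]

lemma thetaQuot_add_coe (τ : ℍ) (w z : ℂ) (l : (periodPair τ).lattice) :
    thetaQuot τ w (z + l) = thetaQuot τ w z := by
  obtain ⟨m, n, hl⟩ := (mem_lattice_iff τ l).1 l.2
  have h1 : Function.Periodic (thetaQuot τ w) (τ : ℂ) := thetaQuot_add_tau τ w
  have h2 : Function.Periodic (thetaQuot τ w) (1 : ℂ) := thetaQuot_add_one τ w
  rw [hl, ← add_assoc]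
  have h3 := (h2.int_mul n) (z + m * τ)
  rw [mul_one] at h3
  rw [h3, (h1.int_mul m) z]

/-- The difference of two values of `℘` as a theta quotient. -/
lemma wp_sub (τ : ℍ) (z w : ℂ) (hz : z ∉ (periodPair τ).lattice)
    (hw : w ∉ (periodPair τ).lattice) :
    (periodPair τ).weierstrassP z - (periodPair τ).weierstrassP w =
      4 * Real.pi ^ 2 * thetaU τ 0 ^ 2 * e2pi w / theta τ w ^ 2 * thetaQuot τ w z := by
  set L := periodPair τ with hL
  set c : ℂ := 4 * Real.pi ^ 2 * thetaU τ 0 ^ 2 * e2pi w / theta τ w ^ 2 with hc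
  have hth : ∀ x, x ∉ L.lattice → theta τ x ≠ 0 := by
    intro x hx
    apply theta_ne_zero
    intro m n h
    exact hx ((mem_lattice_iff τ x).2 ⟨m, n, h⟩)
  have hTan : ∀ x, AnalyticAt ℂ (theta τ) x := (differentiable_theta τ).analyticAt
  have hUan : ∀ x, AnalyticAt ℂ (thetaU τ) x := (differentiable_thetaU τ).analyticAt
  set D : ℂ → ℂ := dslope (fun z => 1 - e2pi z) 0 with hD
  have hDan : AnalyticAt ℂ D 0 := by
    have : DifferentiableOn ℂ D Set.univ := by
      rw [hD, Complex.differentiableOn_dslope Filter.univ_mem]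
      fun_prop
    exact this.analyticAt Filter.univ_mem
  have hD0 : D 0 = -(2 * Real.pi * Complex.I) := by
    rw [hD, dslope_same]
    have : HasDerivAt (fun z => 1 - e2pi z) (-(2 * Real.pi * Complex.I)) 0 := by
      have h1 : HasDerivAt (fun z : ℂ => 2 * Real.pi * Complex.I * z)
        (2 * Real.pi * Complex.I) 0 := by
        simpa using (hasDerivAt_id (0 : ℂ)).const_mul (2 * Real.pi * Complex.I)
      have h2 := h1.cexp.const_sub 1
      simpa [e2pi] using h2
    exact this.deriv
  have hDz : ∀ x, theta τ x = x * (D x * thetaU τ x) := by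
    intro x
    have := sub_smul_dslope (fun z => 1 - e2pi z) 0 x
    simp only [sub_zero, smul_eq_mul, e2pi_zero, sub_self] at this
    rw [theta, ← this, hD]; ring
  have hpi : (Real.pi : ℂ) ≠ 0 := by exact_mod_cast Real.pi_ne_zero
  have hD0' : D 0 ≠ 0 := by
    rw [hD0]; simpa using hpi
  have hU0 := thetaU_zero_ne_zero τ
  obtain ⟨k, hk⟩ := elliptic_const L
    (fun x => L.weierstrassP x - L.weierstrassP w - c * thetaQuot τ w x)
    (fun x => x ^ 2 * L.weierstrassPExcept 0 x + 1 - x ^ 2 * L.weierstrassP w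
      - c * (theta τ (x + w) * theta τ (x - w) / (D x * thetaU τ x) ^ 2))
    (by
      intro x hx
      have h1 := L.analyticOnNhd_weierstrassP x hx
      have h2 : AnalyticAt ℂ (thetaQuot τ w) x := by
        unfold thetaQuot
        refine AnalyticAt.div ?_ ((hTan x).pow 2) (pow_ne_zero 2 (hth x hx))
        exact ((hTan _).fun_comp (by fun_prop)).mul ((hTan _).fun_comp (by fun_prop))
      fun_prop)
    (by
      intro x l
      simp only [PeriodPair.weierstrassP_add_coe, thetaQuot_add_coe])
    (by
      intro x
      simp only [PeriodPair.weierstrassP_neg, thetaQuot_neg])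
    (by
      have h1 := L.analyticAt_weierstrassPExcept 0
      have h2 : AnalyticAt ℂ
          (fun x => theta τ (x + w) * theta τ (x - w) / (D x * thetaU τ x) ^ 2) 0 := by
        refine AnalyticAt.fun_div ?_ ((hDan.mul (hUan 0)).pow 2)
          (pow_ne_zero 2 (mul_ne_zero hD0' hU0))
        exact ((hTan _).fun_comp (by fun_prop)).mul ((hTan _).fun_comp (by fun_prop))
      fun_prop)
    (by
      have h1 := hth w hw
      have h2 := e2pi_ne_zero w
      simp only [zero_add, zero_sub, theta_neg, hD0, hc]
      field_simp
      simp
      norm_num)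
    (by
      filter_upwards with x hx
      have h0 : L.weierstrassP x = L.weierstrassPExcept 0 x + 1 / x ^ 2 := by
        have := L.weierstrassPExcept_add 0 x
        simpa using this.symm
      rw [h0, thetaQuot, hDz x]
      by_cases hh : D x * thetaU τ x = 0
      · simp only [hh]
        field_simp
      · field_simp)
  have e1 := hk w hw
  have e2 := hk z hz
  simp only [thetaQuot, sub_self, theta_zero, mul_zero, zero_div] at e1
  rw [← e1] at e2
  linear_combination e2

/-! ### Assembly -/

lemma discriminant_eq_theta (τ : ℍ) :
    ModularForm.discriminant τ = e2pi τ * thetaU τ 0 ^ 12 := by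
  have h1 : thetaU τ 0 = qProd (e2pi τ) 1 ^ 2 := by
    simp [thetaU, e2pi_zero, sq]
  have h2 := (multipliable_qProd (norm_e2pi_lt τ) 1).tprod_pow 24
  rw [ModularForm.discriminant_eq_q_prod, h1, ← pow_mul, qProd, ← h2]
  simp [ModularForm.eta_q_eq_pow, Function.Periodic.qParam, e2pi]

/-- The exponent of the elementary factor of the Siegel function. -/
def sExp (a b t : ℂ) : ℂ := b * (a - 1) / 2 + (a ^ 2 - a + 1 / 6) / 2 * t

lemma siegel_eq (v : ℚ × ℚ) (τ : ℍ) :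
    siegel v τ = -e2pi (sExp v.1 v.2 τ) * theta τ ((v.1 : ℂ) * τ + v.2) := by
  have hp := (multipliable_qProd (norm_e2pi_lt τ) (e2pi ((v.1 : ℂ) * τ + v.2))).tprod_mul
    (multipliable_qProd (norm_e2pi_lt τ) (e2pi (-((v.1 : ℂ) * τ + v.2))))
  rw [theta, thetaU, qProd, qProd, ← hp, siegel]
  have e1 : Complex.exp (Real.pi * Complex.I * (v.2 : ℂ) * ((v.1 : ℂ) - 1)) *
      qpow τ (((v.1 : ℂ) ^ 2 - (v.1 : ℂ) + 1 / 6) / 2) = e2pi (sExp v.1 v.2 τ) := by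
    rw [qpow, e2pi, ← Complex.exp_add, sExp]
    congr 1; ring
  have e2 : qpow τ (v.1 : ℂ) * e2pi (v.2 : ℂ) = e2pi ((v.1 : ℂ) * τ + v.2) := by
    rw [qpow, e2pi, e2pi, ← Complex.exp_add]
    congr 1; ring
  have e3 : ∀ n : ℕ, qpow τ ((n : ℂ) + 1 + (v.1 : ℂ)) * e2pi (v.2 : ℂ) =
      e2pi τ ^ (n + 1) * e2pi ((v.1 : ℂ) * τ + v.2) := by
    intro n
    rw [qpow, e2pi, e2pi, e2pi, ← Complex.exp_add, ← Complex.exp_nat_mul, ← Complex.exp_add]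
    congr 1; push_cast; ring
  have e4 : ∀ n : ℕ, qpow τ ((n : ℂ) + 1 - (v.1 : ℂ)) * e2pi (-(v.2 : ℂ)) =
      e2pi τ ^ (n + 1) * e2pi (-((v.1 : ℂ) * τ + v.2)) := by
    intro n
    rw [qpow, e2pi, e2pi, e2pi, ← Complex.exp_add, ← Complex.exp_nat_mul, ← Complex.exp_add]
    congr 1; push_cast; ring
  simp only [e2, e3, e4]
  rw [neg_mul, e1]
  ring

lemma not_lattice_of_not_int (v : ℚ × ℚ) (hv : ¬ IsIntPair v) (τ : ℍ) :
    ∀ m n : ℤ, (v.1 : ℂ) * τ + v.2 ≠ m * τ + n := by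
  intro m n h
  apply hv
  have hi := congrArg Complex.im h
  have hr := congrArg Complex.re h
  simp at hi hr
  have hτ := τ.im_pos.ne'
  have h1 : (v.1 : ℝ) = m := by
    rcases hi with hi | hi
    · exact hi
    · exact absurd hi hτ
  have h2 : (v.2 : ℝ) = n := by rw [h1] at hr; linarith
  exact ⟨m, n, by exact_mod_cast h1, by exact_mod_cast h2⟩

lemma sExp_identity (a b c d t : ℂ) :
    e2pi (sExp (a + c) (b + d) t) ^ 6 * e2pi (sExp (a - c) (b - d) t) ^ 6 * e2pi t =
      e2pi (sExp a b t) ^ 12 * e2pi (sExp c d t) ^ 12 * e2pi (c * t + d) ^ 6 := by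
  simp only [e2pi, ← Complex.exp_nat_mul, ← Complex.exp_add]
  congr 1
  simp only [sExp]
  push_cast
  ring

lemma wp_sub_pow_six (u v : ℚ × ℚ) (hu : ¬ IsIntPair u) (hv : ¬ IsIntPair v) (τ : ℍ) :
    (wpfun τ ((u.1 : ℂ) * τ + u.2) - wpfun τ ((v.1 : ℂ) * τ + v.2)) ^ 6 =
      deltaFun τ * ((siegel (u.1 + v.1, u.2 + v.2) τ ^ 6 * siegel (u.1 - v.1, u.2 - v.2) τ ^ 6) /
        (siegel u τ ^ 12 * siegel v τ ^ 12)) := by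
  have hz := not_lattice_of_not_int u hu τ
  have hw := not_lattice_of_not_int v hv τ
  have hz' : ((u.1 : ℂ) * τ + u.2) ∉ (periodPair τ).lattice := by
    rw [mem_lattice_iff]; rintro ⟨m, n, h⟩; exact hz m n h
  have hw' : ((v.1 : ℂ) * τ + v.2) ∉ (periodPair τ).lattice := by
    rw [mem_lattice_iff]; rintro ⟨m, n, h⟩; exact hw m n h
  have tz := theta_ne_zero τ _ hz
  have tw := theta_ne_zero τ _ hw
  rw [wpfun_eq, wpfun_eq, wp_sub τ _ _ hz' hw', deltaFun_eq, discriminant_eq_theta,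
    siegel_eq, siegel_eq, siegel_eq, siegel_eq, thetaQuot]
  have key := sExp_identity u.1 u.2 v.1 v.2 τ
  push_cast
  rw [show ((u.1 : ℂ) + v.1) * τ + (u.2 + v.2) = (u.1 * τ + u.2) + (v.1 * τ + v.2) by ring,
    show ((u.1 : ℂ) - v.1) * τ + (u.2 - v.2) = (u.1 * τ + u.2) - (v.1 * τ + v.2) by ring]
  generalize (theta τ ((u.1 * τ + u.2) + (v.1 * τ + v.2))) = A
  generalize (theta τ ((u.1 * τ + u.2) - (v.1 * τ + v.2))) = B
  have n1 := e2pi_ne_zero (sExp u.1 u.2 τ)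
  have n2 := e2pi_ne_zero (sExp v.1 v.2 τ)
  generalize theta τ (u.1 * τ + u.2) = X at *
  generalize theta τ (v.1 * τ + v.2) = Y at *
  generalize e2pi (sExp u.1 u.2 τ) = P at *
  generalize e2pi (sExp v.1 v.2 τ) = Q at *
  generalize e2pi (sExp (u.1 + v.1) (u.2 + v.2) τ) = R at *
  generalize e2pi (sExp (u.1 - v.1) (u.2 - v.2) τ) = S at *
  generalize e2pi (v.1 * τ + v.2) = W at *
  generalize e2pi τ = T at *
  generalize thetaU τ 0 = U at *
  have e : ∀ x y : ℂ, (-x * y) ^ 6 = x ^ 6 * y ^ 6 := by intros; ring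
  have e' : ∀ x y : ℂ, (-x * y) ^ 12 = x ^ 12 * y ^ 12 := by intros; ring
  rw [e, e, e', e']
  have : (2 * (Real.pi : ℂ)) ^ 12 * (T * U ^ 12) *
      (R ^ 6 * A ^ 6 * (S ^ 6 * B ^ 6) / (P ^ 12 * X ^ 12 * (Q ^ 12 * Y ^ 12))) =
      (2 * (Real.pi : ℂ)) ^ 12 * U ^ 12 * (R ^ 6 * S ^ 6 * T) * (A ^ 6 * B ^ 6) /
        (P ^ 12 * X ^ 12 * (Q ^ 12 * Y ^ 12)) := by ring
  rw [this, key]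
  field_simp
  ring

/-- For `u, v ∈ ℚ² ∖ ℤ²` with `u ≢ ±v (mod ℤ²)` and `τ ∈ ℍ`,
`(f_u(τ) - f_v(τ))⁶ = 2¹²3⁶ j(τ)²(j(τ)-1728)³ g_{u+v}(τ)⁶g_{u-v}(τ)⁶ / (g_u(τ)¹²g_v(τ)¹²)`. -/
theorem fricke_sub_pow_six (u v : ℚ × ℚ) (hu : ¬ IsIntPair u) (hv : ¬ IsIntPair v)
    (huv : ¬ PMEquiv u v) (τ : ℍ) :
    (fricke u τ - fricke v τ) ^ 6 =
      2 ^ 12 * 3 ^ 6 * jfun τ ^ 2 * (jfun τ - 1728) ^ 3 *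
        (siegel (u.1 + v.1, u.2 + v.2) τ ^ 6 * siegel (u.1 - v.1, u.2 - v.2) τ ^ 6) /
        (siegel u τ ^ 12 * siegel v τ ^ 12) := by
  have h := wp_sub_pow_six u v hu hv τ
  have hD := deltaFun_ne_zero τ
  have h0 : jfun τ - 1728 = 1728 * 27 * g3fun τ ^ 2 / deltaFun τ := by
    rw [jfun]
    field_simp
    rw [deltaFun]
    ring
  rw [mul_div_assoc, h0, jfun]
  have hl : fricke u τ - fricke v τ = -(2 ^ 7 * 3 ^ 5 : ℂ) * g2fun τ * g3fun τ / deltaFun τ *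
      (wpfun τ ((u.1 : ℂ) * τ + u.2) - wpfun τ ((v.1 : ℂ) * τ + v.2)) := by
    simp only [fricke]; ring
  rw [hl, mul_pow, h]
  generalize (siegel (u.1 + v.1, u.2 + v.2) τ ^ 6 * siegel (u.1 - v.1, u.2 - v.2) τ ^ 6) /
        (siegel u τ ^ 12 * siegel v τ ^ 12) = K
  field_simp
  ring

end
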